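/- For f ∈ bmo(ℝⁿ), the following are equivalent: (1) f ∈ cmo(ℝⁿ), i.e., there exist continuous functions g_j with compact support in ℝⁿ such that ‖f − g_j‖_{bmo(ℝⁿ)} → 0; (2) lim_{t→0⁺} ω(f,t) = 0 and lim_{β→∞} sup{ |f|_Q : Q a cube with dist(Q,0) > β and ℓ(Q) ≥ 1 } = 0. -/

import Mathlib

open MeasureTheory Metric Filter Topology

noncomputable section

/-- A closed axis-parallel cube in ℝⁿ: a closed ball in the sup norm with
positive radius (`half` = half the sidelength). -/
structure Cube (n : ℕ) where
  center : Fin n → ℝ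
  half : ℝ
  half_pos : 0 < half

namespace Cube

variable {n : ℕ}

/-- The underlying set of a cube. -/
def toSet (Q : Cube n) : Set (Fin n → ℝ) := Metric.closedBall Q.center Q.half

/-- The sidelength ℓ(Q). -/
def side (Q : Cube n) : ℝ := 2 * Q.half

/-- The mean f_Q of f over Q. -/
def avg (Q : Cube n) (f : (Fin n → ℝ) → ℝ) : ℝ := ⨍ x in Q.toSet, f x

/-- Mean oscillation of f over Q. -/
def osc (Q : Cube n) (f : (Fin n → ℝ) → ℝ) : ℝ := ⨍ x in Q.toSet, |f x - Q.avg f|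

/-- The mean |f|_Q of |f| over Q. -/
def avgAbs (Q : Cube n) (f : (Fin n → ℝ) → ℝ) : ℝ := ⨍ x in Q.toSet, |f x|

/-- Distance from the cube to the origin. -/
def distToOrigin (Q : Cube n) : ℝ := Metric.infDist (0 : Fin n → ℝ) Q.toSet

/-- The cube 2Q, concentric with Q and of twice the sidelength. -/
def double (Q : Cube n) : Cube n := ⟨Q.center, 2 * Q.half, mul_pos two_pos Q.half_pos⟩

end Cube

variable {n : ℕ}

/-- The modulus of mean oscillation ω_U(f,t): the supremum of the mean oscillation
of f over cubes Q ⊆ U of sidelength < t. -/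
def omegaOn (U : Set (Fin n → ℝ)) (f : (Fin n → ℝ) → ℝ) (t : ℝ) : ℝ :=
  sSup {r | ∃ Q : Cube n, Q.toSet ⊆ U ∧ Q.side < t ∧ r = Q.osc f}

/-- sup{ |f|_Q : Q ⊆ U, ℓ(Q) ≥ lam }. -/
def bigAvgSup (U : Set (Fin n → ℝ)) (lam : ℝ) (f : (Fin n → ℝ) → ℝ) : ℝ :=
  sSup {r | ∃ Q : Cube n, Q.toSet ⊆ U ∧ lam ≤ Q.side ∧ r = Q.avgAbs f}

/-- The nonhomogeneous norm ‖f‖_{bmo_lam(U)}. -/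
def bmoNorm (U : Set (Fin n → ℝ)) (lam : ℝ) (f : (Fin n → ℝ) → ℝ) : ℝ :=
  omegaOn U f lam + bigAvgSup U lam f

/-- Membership in bmo_lam(U): integrable on every cube in U and finite norm. -/
def MemBmo (U : Set (Fin n → ℝ)) (lam : ℝ) (f : (Fin n → ℝ) → ℝ) : Prop :=
  (∀ Q : Cube n, Q.toSet ⊆ U → IntegrableOn f Q.toSet) ∧
  BddAbove {r | ∃ Q : Cube n, Q.toSet ⊆ U ∧ Q.side < lam ∧ r = Q.osc f} ∧
  BddAbove {r | ∃ Q : Cube n, Q.toSet ⊆ U ∧ lam ≤ Q.side ∧ r = Q.avgAbs f}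

/-- Sarason's vanishing mean oscillation condition: ω_U(f,t) → 0 as t → 0⁺. -/
def VanishSmallOsc (U : Set (Fin n → ℝ)) (f : (Fin n → ℝ) → ℝ) : Prop :=
  Tendsto (fun t => omegaOn U f t) (nhdsWithin 0 (Set.Ioi 0)) (nhds 0)

/-- f is bounded on U. -/
def BoundedOn (U : Set (Fin n → ℝ)) (f : (Fin n → ℝ) → ℝ) : Prop :=
  ∃ M : ℝ, ∀ x ∈ U, |f x| ≤ M

/-- f is Lipschitz on U. -/
def LipschitzOn (U : Set (Fin n → ℝ)) (f : (Fin n → ℝ) → ℝ) : Prop :=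
  ∃ K : NNReal, LipschitzOnWith K f U

/-- dist(supp f, ∂U) > 0. -/
def SuppAway (U : Set (Fin n → ℝ)) (f : (Fin n → ℝ) → ℝ) : Prop :=
  ∃ d > 0, ∀ x ∈ Function.support f, ∀ y ∈ frontier U, d ≤ dist x y

/-- The nonhomogeneous Lipschitz norm ‖f‖_{Lip_b(U)} = ‖f‖_∞ + Lipschitz seminorm. -/
def lipbNorm (U : Set (Fin n → ℝ)) (f : (Fin n → ℝ) → ℝ) : ℝ :=
  sSup {r | ∃ x ∈ U, r = |f x|} +
  sSup {r | ∃ x ∈ U, ∃ y ∈ U, x ≠ y ∧ r = |f x - f y| / dist x y}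

/-- U is a domain: a nonempty open connected subset of ℝⁿ. -/
def IsRealDomain (U : Set (Fin n → ℝ)) : Prop := IsOpen U ∧ IsConnected U

/-- U is an (ε,δ)-domain. -/
def IsEpsDeltaDomain (U : Set (Fin n → ℝ)) (ε δ : ℝ) : Prop :=
  ∀ x ∈ U, ∀ y ∈ U, dist x y < δ →
    ∃ γ : ℝ → (Fin n → ℝ), ContinuousOn γ (Set.Icc 0 1) ∧ γ 0 = x ∧ γ 1 = y ∧
      (∀ t ∈ Set.Icc (0:ℝ) 1, γ t ∈ U) ∧
      eVariationOn γ (Set.Icc 0 1) ≤ ENNReal.ofReal (ε⁻¹ * dist x y) ∧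
      ∀ t ∈ Set.Icc (0:ℝ) 1,
        ε * (dist (γ t) x * dist (γ t) y) / dist x y ≤ Metric.infDist (γ t) (frontier U)

/-- The natural scale λ_{ε,δ} for an (ε,δ)-domain. -/
def lamED (n : ℕ) (ε δ : ℝ) : ℝ := ε ^ 2 * δ / (320 * n * (1 + Real.sqrt n * ε))

/-- d_Ω(x) = dist(x,∂Ω). -/
def distBd (U : Set (Fin n → ℝ)) (x : Fin n → ℝ) : ℝ := Metric.infDist x (frontier U)

/-- Ω̊_t = {x ∈ Ω : d_Ω(x) ≥ t}. -/
def innerPart (U : Set (Fin n → ℝ)) (t : ℝ) : Set (Fin n → ℝ) :=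
  {x ∈ U | t ≤ distBd U x}

/-- f vanishes at infinity in the bmo_lam(U) sense. -/
def VanishAtInfinity (U : Set (Fin n → ℝ)) (lam : ℝ) (f : (Fin n → ℝ) → ℝ) : Prop :=
  Tendsto (fun R => bmoNorm (U \ Metric.closedBall 0 R) lam f) atTop (nhds 0)

/-- f vanishes at the boundary in the bmo_lam(U) sense. -/
def VanishAtBoundary (U : Set (Fin n → ℝ)) (lam : ℝ) (f : (Fin n → ℝ) → ℝ) : Prop :=
  Tendsto (fun t => bmoNorm (U \ innerPart U t) lam f) (nhdsWithin 0 (Set.Ioi 0)) (nhds 0)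

/-- f is in the bmo_lam(U)-closure of the continuous functions with compact support in U. -/
def InCmoClosure (U : Set (Fin n → ℝ)) (lam : ℝ) (f : (Fin n → ℝ) → ℝ) : Prop :=
  ∃ g : ℕ → (Fin n → ℝ) → ℝ,
    (∀ j, Continuous (g j) ∧ HasCompactSupport (g j) ∧ tsupport (g j) ⊆ U) ∧
    Tendsto (fun j => bmoNorm U lam (f - g j)) atTop (nhds 0)

/-- The homogeneous BMO(ℝⁿ) seminorm: sup of mean oscillation over all cubes. -/
def bmoHNorm (f : (Fin n → ℝ) → ℝ) : ℝ := sSup {r | ∃ Q : Cube n, r = Q.osc f}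

namespace Cube

lemma toSet_def (Q : Cube n) : Q.toSet = closedBall Q.center Q.half := rfl

lemma side_pos (Q : Cube n) : 0 < Q.side := mul_pos two_pos Q.half_pos

lemma volume_toSet (Q : Cube n) : volume Q.toSet = ENNReal.ofReal (Q.side ^ n) := by
  rw [toSet_def, Real.volume_pi_closedBall _ Q.half_pos.le, Fintype.card_fin, side]

lemma volume_real_toSet (Q : Cube n) : volume.real Q.toSet = Q.side ^ n := by
  rw [Measure.real, volume_toSet, ENNReal.toReal_ofReal (pow_nonneg Q.side_pos.le n)]

lemma measurableSet_toSet (Q : Cube n) : MeasurableSet Q.toSet :=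
  isClosed_closedBall.measurableSet

lemma isCompact_toSet (Q : Cube n) : IsCompact Q.toSet := isCompact_closedBall _ _

lemma volume_toSet_ne_top (Q : Cube n) : volume Q.toSet ≠ ⊤ := by
  rw [volume_toSet]; exact ENNReal.ofReal_ne_top

lemma avg_eq (Q : Cube n) (f : (Fin n → ℝ) → ℝ) :
    Q.avg f = (Q.side ^ n)⁻¹ * ∫ x in Q.toSet, f x := by
  rw [avg, setAverage_eq, volume_real_toSet, smul_eq_mul]

lemma avgAbs_eq_avg (Q : Cube n) (f : (Fin n → ℝ) → ℝ) :
    Q.avgAbs f = Q.avg fun x => |f x| := rfl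

lemma osc_eq_avg (Q : Cube n) (f : (Fin n → ℝ) → ℝ) :
    Q.osc f = Q.avg fun x => |f x - Q.avg f| := rfl

lemma integrableOn_const (Q : Cube n) (c : ℝ) : IntegrableOn (fun _ => c) Q.toSet :=
  MeasureTheory.integrableOn_const Q.volume_toSet_ne_top

lemma avg_const (Q : Cube n) (c : ℝ) : Q.avg (fun _ => c) = c := by
  rw [avg_eq, setIntegral_const, volume_real_toSet, smul_eq_mul,
    inv_mul_cancel_left₀ (pow_pos Q.side_pos n).ne']

lemma avg_add (Q : Cube n) {f g : (Fin n → ℝ) → ℝ} (hf : IntegrableOn f Q.toSet)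
    (hg : IntegrableOn g Q.toSet) : Q.avg (fun x => f x + g x) = Q.avg f + Q.avg g := by
  rw [avg_eq, avg_eq, avg_eq, integral_add hf hg, mul_add]

lemma avg_neg (Q : Cube n) (f : (Fin n → ℝ) → ℝ) : Q.avg (fun x => -f x) = -Q.avg f := by
  rw [avg_eq, avg_eq, integral_neg, mul_neg]

lemma avg_mono (Q : Cube n) {f g : (Fin n → ℝ) → ℝ} (hf : IntegrableOn f Q.toSet)
    (hg : IntegrableOn g Q.toSet) (h : ∀ x ∈ Q.toSet, f x ≤ g x) : Q.avg f ≤ Q.avg g := by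
  rw [avg_eq, avg_eq]
  exact mul_le_mul_of_nonneg_left (setIntegral_mono_on hf hg Q.measurableSet_toSet h)
    (inv_nonneg.2 (pow_nonneg Q.side_pos.le n))

lemma avg_nonneg (Q : Cube n) {f : (Fin n → ℝ) → ℝ} (h : ∀ x, 0 ≤ f x) : 0 ≤ Q.avg f := by
  rw [avg_eq]
  exact mul_nonneg (inv_nonneg.2 (pow_nonneg Q.side_pos.le n)) (integral_nonneg h)

lemma avgAbs_nonneg (Q : Cube n) (f : (Fin n → ℝ) → ℝ) : 0 ≤ Q.avgAbs f :=
  Q.avg_nonneg fun _ => abs_nonneg _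

lemma osc_nonneg (Q : Cube n) (f : (Fin n → ℝ) → ℝ) : 0 ≤ Q.osc f :=
  Q.avg_nonneg fun _ => abs_nonneg _

lemma abs_avg_le (Q : Cube n) (f : (Fin n → ℝ) → ℝ) : |Q.avg f| ≤ Q.avgAbs f := by
  rw [avgAbs_eq_avg, avg_eq, avg_eq, abs_mul,
    abs_of_nonneg (inv_nonneg.2 (pow_nonneg Q.side_pos.le n))]
  exact mul_le_mul_of_nonneg_left (abs_integral_le_integral_abs)
    (inv_nonneg.2 (pow_nonneg Q.side_pos.le n))

lemma avgAbs_le (Q : Cube n) {f : (Fin n → ℝ) → ℝ} (hf : IntegrableOn f Q.toSet) {M : ℝ}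
    (h : ∀ x ∈ Q.toSet, |f x| ≤ M) : Q.avgAbs f ≤ M := by
  rw [avgAbs_eq_avg, ← Q.avg_const M]
  exact Q.avg_mono hf.abs (Q.integrableOn_const _) h

lemma avgAbs_add_le (Q : Cube n) {f g : (Fin n → ℝ) → ℝ} (hf : IntegrableOn f Q.toSet)
    (hg : IntegrableOn g Q.toSet) :
    Q.avgAbs (fun x => f x + g x) ≤ Q.avgAbs f + Q.avgAbs g := by
  rw [avgAbs_eq_avg, avgAbs_eq_avg, avgAbs_eq_avg, ← Q.avg_add hf.abs hg.abs]
  exact Q.avg_mono (hf.add hg).abs (hf.abs.add hg.abs) fun x _ => abs_add_le _ _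

lemma integrableOn_sub_const (Q : Cube n) {f : (Fin n → ℝ) → ℝ} (hf : IntegrableOn f Q.toSet)
    (c : ℝ) : IntegrableOn (fun x => f x - c) Q.toSet :=
  hf.sub (Q.integrableOn_const c)

lemma avg_sub_const (Q : Cube n) {f : (Fin n → ℝ) → ℝ} (hf : IntegrableOn f Q.toSet) (c : ℝ) :
    Q.avg (fun x => f x - c) = Q.avg f - c := by
  simp only [sub_eq_add_neg]
  rw [Q.avg_add hf (Q.integrableOn_const _), avg_const]

lemma osc_le_two_mul (Q : Cube n) {f : (Fin n → ℝ) → ℝ} (hf : IntegrableOn f Q.toSet) (c : ℝ) :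
    Q.osc f ≤ 2 * Q.avgAbs (fun x => f x - c) := by
  have h := Q.avgAbs_add_le (Q.integrableOn_sub_const hf c) (Q.integrableOn_const (c - Q.avg f))
  have h2 : Q.avgAbs (fun _ => c - Q.avg f) = |Q.avg f - c| := by
    rw [avgAbs_eq_avg, avg_const, abs_sub_comm]
  have h3 := Q.abs_avg_le (fun x => f x - c)
  rw [Q.avg_sub_const hf] at h3
  simp only [sub_add_sub_cancel] at h
  have h4 : Q.osc f = Q.avgAbs fun x => f x - Q.avg f := rfl
  linarith

lemma osc_le_two_mul_avgAbs (Q : Cube n) {f : (Fin n → ℝ) → ℝ} (hf : IntegrableOn f Q.toSet) :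
    Q.osc f ≤ 2 * Q.avgAbs f := by
  simpa using Q.osc_le_two_mul hf 0

lemma osc_add_le (Q : Cube n) {f g : (Fin n → ℝ) → ℝ} (hf : IntegrableOn f Q.toSet)
    (hg : IntegrableOn g Q.toSet) : Q.osc (fun x => f x + g x) ≤ Q.osc f + Q.osc g := by
  have h := Q.avgAbs_add_le (Q.integrableOn_sub_const hf (Q.avg f))
    (Q.integrableOn_sub_const hg (Q.avg g))
  have h4 : Q.osc (fun x => f x + g x) =
      Q.avgAbs fun x => f x - Q.avg f + (g x - Q.avg g) := by
    rw [osc_eq_avg, Q.avg_add hf hg, avgAbs_eq_avg]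
    congr 1; ext x; congr 1; ring
  exact h4.trans_le h

lemma osc_neg (Q : Cube n) (f : (Fin n → ℝ) → ℝ) : Q.osc (fun x => -f x) = Q.osc f := by
  rw [osc_eq_avg, osc_eq_avg, avg_neg]
  congr 1; ext x; rw [← abs_neg]; congr 1; ring

lemma avgAbs_le_of_subset {Q R : Cube n} (h : Q.toSet ⊆ R.toSet) {f : (Fin n → ℝ) → ℝ}
    (hf : IntegrableOn f R.toSet) :
    Q.avgAbs f ≤ (R.side / Q.side) ^ n * R.avgAbs f := by
  rw [avgAbs_eq_avg, avgAbs_eq_avg, avg_eq, avg_eq, div_pow, ← mul_assoc, div_mul_eq_mul_div,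
    mul_inv_cancel₀ (pow_pos R.side_pos n).ne', one_div]
  refine mul_le_mul_of_nonneg_left ?_ (inv_nonneg.2 (pow_nonneg Q.side_pos.le n))
  exact setIntegral_mono_set hf.abs (ae_of_all _ fun x => abs_nonneg _) h.eventuallyLE

lemma abs_avg_sub_avg_le {Q R : Cube n} (h : Q.toSet ⊆ R.toSet) {f : (Fin n → ℝ) → ℝ}
    (hf : IntegrableOn f R.toSet) :
    |Q.avg f - R.avg f| ≤ (R.side / Q.side) ^ n * R.osc f := by
  rw [← Q.avg_sub_const (hf.mono_set h)]
  exact (Q.abs_avg_le _).trans (avgAbs_le_of_subset h (R.integrableOn_sub_const hf _))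

/-- Means over a cube are controlled by means over translates of a smaller cube. -/
lemma avg_le_of_forall_small {F : (Fin n → ℝ) → ℝ} (hF : ∀ Q : Cube n, IntegrableOn F Q.toSet)
    (h0 : ∀ x, 0 ≤ F x) {δ : ℝ} (hδ : 0 < δ) {M : ℝ}
    (hM : ∀ c, Cube.avg ⟨c, δ, hδ⟩ F ≤ M) (Q : Cube n) (hQ : δ ≤ Q.half) :
    Q.avg F ≤ 2 ^ n * M := by
  have hM0 : 0 ≤ M := (avg_nonneg _ h0).trans (hM 0)
  let Q' : Cube n := ⟨Q.center, Q.half + δ, add_pos Q.half_pos hδ⟩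
  let G : (Fin n → ℝ) → ENNReal := fun x => ENNReal.ofReal (F x)
  have hint (R : Cube n) : ∫⁻ x in R.toSet, G x = ENNReal.ofReal (∫ x in R.toSet, F x) :=
    (ofReal_integral_eq_lintegral_ofReal (hF R) (ae_of_all _ h0)).symm
  have hδn : (0 : ℝ) < (2 * δ) ^ n := by positivity
  have hball (c : Fin n → ℝ) :
      ∫⁻ x in closedBall c δ, G x ≤ ENNReal.ofReal ((2 * δ) ^ n * M) := by
    refine (hint ⟨c, δ, hδ⟩).trans_le (ENNReal.ofReal_le_ofReal ?_)
    have := hM c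
    rw [avg_eq] at this
    exact (inv_mul_le_iff₀ hδn).1 this
  let S : Set ((Fin n → ℝ) × (Fin n → ℝ)) := {p | dist p.1 p.2 ≤ δ}
  have hS : MeasurableSet S :=
    (isClosed_le (continuous_fst.dist continuous_snd) continuous_const).measurableSet
  have hG : AEMeasurable G (volume.restrict Q.toSet) :=
    (hF Q).1.aemeasurable.ennreal_ofReal
  have hswap : ∫⁻ x in Q.toSet, ∫⁻ y in Q'.toSet, S.indicator (fun p => G p.1) (x, y) =
      ∫⁻ y in Q'.toSet, ∫⁻ x in Q.toSet, S.indicator (fun p => G p.1) (x, y) := by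
    refine lintegral_lintegral_swap ?_
    exact (hG.comp_fst).indicator hS
  have hleft : (∫⁻ x in Q.toSet, G x) * ENNReal.ofReal ((2 * δ) ^ n) ≤
      ∫⁻ x in Q.toSet, ∫⁻ y in Q'.toSet, S.indicator (fun p => G p.1) (x, y) := by
    rw [← lintegral_mul_const'' _ hG]
    refine setLIntegral_mono' Q.measurableSet_toSet fun x hx => ?_
    have hsub : closedBall x δ ⊆ Q'.toSet :=
      closedBall_subset_closedBall' (by
        have : dist x Q.center ≤ Q.half := hx
        change δ + dist x Q.center ≤ Q.half + δ
        linarith)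
    calc G x * ENNReal.ofReal ((2 * δ) ^ n) = ∫⁻ _ in closedBall x δ, G x := by
          rw [setLIntegral_const, Real.volume_pi_closedBall _ hδ.le, Fintype.card_fin]
      _ = ∫⁻ y in closedBall x δ, S.indicator (fun p => G p.1) (x, y) := by
          refine setLIntegral_congr_fun isClosed_closedBall.measurableSet fun y hy => ?_
          have : (x, y) ∈ S := mem_closedBall'.1 hy
          rw [Set.indicator_of_mem this]
      _ ≤ _ := lintegral_mono_set hsub
  have hright : ∫⁻ y in Q'.toSet, ∫⁻ x in Q.toSet, S.indicator (fun p => G p.1) (x, y) ≤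
      ENNReal.ofReal ((2 * δ) ^ n * M) * ENNReal.ofReal (Q'.side ^ n) := by
    rw [← volume_toSet, ← setLIntegral_const]
    refine lintegral_mono fun y => ?_
    refine le_trans ?_ (hball y)
    rw [← lintegral_indicator isClosed_closedBall.measurableSet]
    refine (setLIntegral_le_lintegral _ _).trans (lintegral_mono fun x => ?_)
    by_cases hx : dist x y ≤ δ
    · rw [Set.indicator_of_mem (show x ∈ closedBall y δ from hx),
        Set.indicator_of_mem (show (x, y) ∈ S from hx)]
    · rw [Set.indicator_of_notMem (show (x, y) ∉ S from hx)]
      exact zero_le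
  have hfin := hleft.trans (hswap.le.trans hright)
  rw [hint, ← ENNReal.ofReal_mul (setIntegral_nonneg Q.measurableSet_toSet fun x _ => h0 x),
    ← ENNReal.ofReal_mul (by positivity),
    ENNReal.ofReal_le_ofReal_iff
      (mul_nonneg (by positivity) (pow_nonneg Q'.side_pos.le n))] at hfin
  have h1 : ∫ x in Q.toSet, F x ≤ M * Q'.side ^ n := by
    refine le_of_mul_le_mul_right (hfin.trans_eq ?_) hδn
    ring
  have h2 : Q'.side ^ n ≤ 2 ^ n * Q.side ^ n := by
    rw [← mul_pow]
    refine pow_le_pow_left₀ Q'.side_pos.le ?_ n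
    change 2 * (Q.half + δ) ≤ 2 * (2 * Q.half)
    linarith
  rw [avg_eq, inv_mul_le_iff₀ (pow_pos Q.side_pos n)]
  calc _ ≤ M * Q'.side ^ n := h1
    _ ≤ M * (2 ^ n * Q.side ^ n) := mul_le_mul_of_nonneg_left h2 hM0
    _ = _ := by ring

lemma continuous_avg {f : (Fin n → ℝ) → ℝ} (hf : ∀ Q : Cube n, IntegrableOn f Q.toSet)
    {δ : ℝ} (hδ : 0 < δ) : Continuous fun c => Cube.avg ⟨c, δ, hδ⟩ f := by
  simp only [avg_eq, side, toSet_def]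
  refine Continuous.mul continuous_const (continuous_iff_continuousAt.2 ?_)
  intro c
  simp_rw [← integral_indicator (isClosed_closedBall (α := Fin n → ℝ)).measurableSet]
  let R : Cube n := ⟨c, δ + 1, by positivity⟩
  refine continuousAt_of_dominated (bound := R.toSet.indicator fun x => |f x|)
    (Eventually.of_forall fun x => ?_) ?_ ?_ ?_
  · exact (aestronglyMeasurable_indicator_iff isClosed_closedBall.measurableSet).2
      (hf ⟨x, δ, hδ⟩).1
  · filter_upwards [closedBall_mem_nhds c one_pos] with x hx
    refine ae_of_all _ fun y => ?_
    by_cases hy : y ∈ closedBall x δ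
    · have : y ∈ R.toSet := closedBall_subset_closedBall' (by
        have : dist x c ≤ 1 := hx
        change δ + dist x c ≤ δ + 1
        linarith) hy
      rw [Set.indicator_of_mem hy, Set.indicator_of_mem this, Real.norm_eq_abs]
    · rw [Set.indicator_of_notMem hy, norm_zero]
      exact Set.indicator_nonneg (fun _ _ => abs_nonneg _) _
  · exact (integrable_indicator_iff R.measurableSet_toSet).2 (hf R).abs
  · have hs : ∀ᵐ y : Fin n → ℝ, y ∉ sphere c δ :=
      measure_eq_zero_iff_ae_notMem.1 (Measure.addHaar_sphere_of_ne_zero _ c hδ.ne')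
    filter_upwards [hs] with y hy
    rcases lt_or_gt_of_ne (show dist y c ≠ δ from hy) with h | h
    · have : ∀ᶠ x in 𝓝 c, dist y x < δ :=
        (continuous_const.dist continuous_id).continuousAt.eventually_lt continuousAt_const h
      refine continuousAt_const.congr (f := fun _ => f y) ?_
      filter_upwards [this] with x hx
      rw [Set.indicator_of_mem (show y ∈ closedBall x δ from hx.le)]
    · have : ∀ᶠ x in 𝓝 c, δ < dist y x :=
        continuousAt_const.eventually_lt (continuous_const.dist continuous_id).continuousAt h
      refine continuousAt_const.congr (f := fun _ => (0 : ℝ)) ?_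
      filter_upwards [this] with x hx
      rw [Set.indicator_of_notMem (show y ∉ closedBall x δ from not_le.2 hx)]

end Cube

lemma bmoNorm_univ_le {f : (Fin n → ℝ) → ℝ} {a b : ℝ} (ha : 0 ≤ a) (hb : 0 ≤ b)
    (h1 : ∀ Q : Cube n, Q.side < 1 → Q.osc f ≤ a)
    (h2 : ∀ Q : Cube n, 1 ≤ Q.side → Q.avgAbs f ≤ b) :
    bmoNorm Set.univ 1 f ≤ a + b := by
  refine add_le_add (Real.sSup_le ?_ ha) (Real.sSup_le ?_ hb)
  · rintro _ ⟨Q, -, hQ, rfl⟩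
    exact h1 Q hQ
  · rintro _ ⟨Q, -, hQ, rfl⟩
    exact h2 Q hQ

lemma omegaOn_nonneg (U : Set (Fin n → ℝ)) (f : (Fin n → ℝ) → ℝ) (t : ℝ) :
    0 ≤ omegaOn U f t := by
  refine Real.sSup_nonneg ?_
  rintro _ ⟨Q, -, -, rfl⟩
  exact Q.osc_nonneg f

lemma bigAvgSup_nonneg (U : Set (Fin n → ℝ)) (lam : ℝ) (f : (Fin n → ℝ) → ℝ) :
    0 ≤ bigAvgSup U lam f := by
  refine Real.sSup_nonneg ?_
  rintro _ ⟨Q, -, -, rfl⟩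
  exact Q.avgAbs_nonneg f

lemma bmoNorm_nonneg (U : Set (Fin n → ℝ)) (lam : ℝ) (f : (Fin n → ℝ) → ℝ) :
    0 ≤ bmoNorm U lam f :=
  add_nonneg (omegaOn_nonneg U f lam) (bigAvgSup_nonneg U lam f)

lemma MemBmo.osc_le {U : Set (Fin n → ℝ)} {lam : ℝ} {f : (Fin n → ℝ) → ℝ} (hf : MemBmo U lam f)
    {t : ℝ} (ht : t ≤ lam) {Q : Cube n} (hQU : Q.toSet ⊆ U) (hQ : Q.side < t) :
    Q.osc f ≤ omegaOn U f t := by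
  refine le_csSup (hf.2.1.mono ?_) ⟨Q, hQU, hQ, rfl⟩
  rintro _ ⟨R, hRU, hR, rfl⟩
  exact ⟨R, hRU, hR.trans_le ht, rfl⟩

lemma MemBmo.osc_le_bmoNorm {U : Set (Fin n → ℝ)} {lam : ℝ} {f : (Fin n → ℝ) → ℝ}
    (hf : MemBmo U lam f) {Q : Cube n} (hQU : Q.toSet ⊆ U) (hQ : Q.side < lam) :
    Q.osc f ≤ bmoNorm U lam f :=
  (hf.osc_le le_rfl hQU hQ).trans (le_add_of_nonneg_right (bigAvgSup_nonneg U lam f))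

lemma MemBmo.avgAbs_le_bmoNorm {U : Set (Fin n → ℝ)} {lam : ℝ} {f : (Fin n → ℝ) → ℝ}
    (hf : MemBmo U lam f) {Q : Cube n} (hQU : Q.toSet ⊆ U) (hQ : lam ≤ Q.side) :
    Q.avgAbs f ≤ bmoNorm U lam f :=
  (le_csSup hf.2.2 ⟨Q, hQU, hQ, rfl⟩).trans
    (le_add_of_nonneg_left (omegaOn_nonneg U f lam))

lemma MemBmo.sub_bounded {f g : (Fin n → ℝ) → ℝ} (hf : MemBmo Set.univ 1 f)
    (hg : Continuous g) {M : ℝ} (hM : ∀ x, |g x| ≤ M) : MemBmo Set.univ 1 (f - g) := by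
  have hfi (Q : Cube n) : IntegrableOn f Q.toSet := hf.1 Q (Set.subset_univ _)
  have hgi (Q : Cube n) : IntegrableOn (fun x => -g x) Q.toSet :=
    hg.neg.continuousOn.integrableOn_compact Q.isCompact_toSet
  have hgM (Q : Cube n) : Q.avgAbs (fun x => -g x) ≤ M :=
    Q.avgAbs_le (hgi Q) fun x _ => (abs_neg (g x)).trans_le (hM x)
  have hsub : f - g = fun x => f x + -g x := by
    ext x
    simp [sub_eq_add_neg]
  obtain ⟨-, ⟨a, ha⟩, ⟨b, hb⟩⟩ := hf
  rw [hsub]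
  refine ⟨fun Q _ => (hfi Q).add (hgi Q), ⟨a + 2 * M, ?_⟩, ⟨b + M, ?_⟩⟩
  · rintro _ ⟨Q, hQU, hQ, rfl⟩
    have h1 := ha ⟨Q, hQU, hQ, rfl⟩
    have h2 := Q.osc_add_le (hfi Q) (hgi Q)
    have h3 := Q.osc_le_two_mul_avgAbs (hgi Q)
    linarith [hgM Q]
  · rintro _ ⟨Q, hQU, hQ, rfl⟩
    have h1 := hb ⟨Q, hQU, hQ, rfl⟩
    have h2 := Q.avgAbs_add_le (hfi Q) (hgi Q)
    linarith [hgM Q]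

lemma exists_forall_osc_le {f : (Fin n → ℝ) → ℝ} (hf : MemBmo Set.univ 1 f)
    (h : VanishSmallOsc Set.univ f) {ε : ℝ} (hε : 0 < ε) :
    ∃ t > 0, ∀ Q : Cube n, Q.side < t → Q.osc f ≤ ε := by
  have h1 : ∀ᶠ t in 𝓝[>] (0 : ℝ), omegaOn Set.univ f t < ε ∧ t ∈ Set.Ioo 0 1 :=
    (h.eventually_lt_const hε).and (Ioo_mem_nhdsGT one_pos)
  obtain ⟨t, ht, ht0, ht1⟩ := h1.exists
  exact ⟨t, ht0, fun Q hQ => (hf.osc_le ht1.le (Set.subset_univ _) hQ).trans ht.le⟩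

lemma vanishSmallOsc_of_forall {f : (Fin n → ℝ) → ℝ}
    (h : ∀ ε > 0, ∃ t > 0, ∀ Q : Cube n, Q.side < t → Q.osc f ≤ ε) :
    VanishSmallOsc Set.univ f := by
  refine tendsto_order.2 ⟨fun a ha => Eventually.of_forall fun t =>
    ha.trans_le (omegaOn_nonneg _ f t), fun ε hε => ?_⟩
  obtain ⟨t, ht, hosc⟩ := h (ε / 2) (half_pos hε)
  filter_upwards [Ioo_mem_nhdsGT ht] with s hs
  refine lt_of_le_of_lt (Real.sSup_le ?_ (half_pos hε).le) (half_lt_self hε)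
  rintro _ ⟨Q, -, hQ, rfl⟩
  exact hosc Q (hQ.trans hs.2)

lemma exists_forall_osc_le_of_uniformContinuous {g : (Fin n → ℝ) → ℝ} (hg : UniformContinuous g)
    {ε : ℝ} (hε : 0 < ε) : ∃ t > 0, ∀ Q : Cube n, Q.side < t → Q.osc g ≤ ε := by
  obtain ⟨t, ht, h⟩ := Metric.uniformContinuous_iff.1 hg (ε / 2) (half_pos hε)
  refine ⟨t, ht, fun Q hQ => ?_⟩
  have hgi : IntegrableOn g Q.toSet :=
    hg.continuous.continuousOn.integrableOn_compact Q.isCompact_toSet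
  have h1 := Q.osc_le_two_mul hgi (g Q.center)
  have h2 : Q.avgAbs (fun x => g x - g Q.center) ≤ ε / 2 := by
    refine Q.avgAbs_le (Q.integrableOn_sub_const hgi _) fun x hx => ?_
    have hx' : dist x Q.center ≤ Q.half := hx
    have hQ' : 2 * Q.half < t := hQ
    exact (h (by linarith [Q.half_pos])).le
  linarith

/-- Local averages at a scale where the oscillation is small approximate `f` in `bmo`. -/
lemma osc_avgAbs_sub_localAvg_le {f : (Fin n → ℝ) → ℝ}
    (hf : ∀ Q : Cube n, IntegrableOn f Q.toSet) {δ : ℝ} (hδ : 0 < δ) {η : ℝ}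
    (hη : ∀ Q : Cube n, Q.half ≤ 2 * δ → Q.osc f ≤ η) (Q : Cube n) :
    Q.osc (fun x => f x - Cube.avg ⟨x, δ, hδ⟩ f) ≤ 2 * 2 ^ n * (1 + 2 * 2 ^ n) * η ∧
      (δ ≤ Q.half →
        Q.avgAbs (fun x => f x - Cube.avg ⟨x, δ, hδ⟩ f) ≤ 2 ^ n * (1 + 2 * 2 ^ n) * η) := by
  set h : (Fin n → ℝ) → ℝ := fun x => Cube.avg ⟨x, δ, hδ⟩ f
  have hcont : Continuous h := Cube.continuous_avg hf hδ
  have hhi (R : Cube n) : IntegrableOn h R.toSet :=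
    hcont.continuousOn.integrableOn_compact R.isCompact_toSet
  have hfh (R : Cube n) : IntegrableOn (fun x => f x - h x) R.toSet := (hf R).sub (hhi R)
  have hpt (c x : Fin n → ℝ) (hx : dist x c ≤ δ) : |h x - h c| ≤ 2 * 2 ^ n * η := by
    let R : Cube n := ⟨c, 2 * δ, by positivity⟩
    have key (y : Fin n → ℝ) (hy : dist y c ≤ δ) : |h y - R.avg f| ≤ 2 ^ n * η := by
      have hsub : (⟨y, δ, hδ⟩ : Cube n).toSet ⊆ R.toSet :=
        closedBall_subset_closedBall' (by linarith)
      have h1 := Cube.abs_avg_sub_avg_le hsub (hf R)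
      have h2 : R.side / (⟨y, δ, hδ⟩ : Cube n).side = 2 := by
        simp only [Cube.side, R]
        field_simp
      rw [h2] at h1
      exact h1.trans (mul_le_mul_of_nonneg_left (hη R le_rfl) (by positivity))
    have h1 := abs_sub_le (h x) (R.avg f) (h c)
    have h2 := key x hx
    have h3 := key c (by simpa using hδ.le)
    rw [abs_sub_comm (R.avg f)] at h1
    linarith
  have hη0 : 0 ≤ η := (Cube.osc_nonneg ⟨0, δ, hδ⟩ f).trans (hη _ (by linarith))
  have hbig : ∀ R : Cube n, δ ≤ R.half →
      R.avgAbs (fun x => f x - h x) ≤ 2 ^ n * (1 + 2 * 2 ^ n) * η := by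
    intro R hR
    rw [mul_assoc]
    refine Cube.avg_le_of_forall_small (F := fun x => |f x - h x|)
      (fun Q => (hfh Q).abs) (fun x => abs_nonneg _) hδ (fun c => ?_) R hR
    let P : Cube n := ⟨c, δ, hδ⟩
    have h1 : P.avgAbs (fun x => (f x - P.avg f) + (h c - h x)) ≤
        P.osc f + P.avgAbs (fun x => h c - h x) :=
      P.avgAbs_add_le (P.integrableOn_sub_const (hf P) _) ((P.integrableOn_const _).sub (hhi P))
    have h2 : P.avgAbs (fun x => h c - h x) ≤ 2 * 2 ^ n * η := by
      refine P.avgAbs_le ((P.integrableOn_const _).sub (hhi P)) fun x hx => ?_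
      rw [Pi.sub_apply, abs_sub_comm]
      exact hpt c x hx
    have h3 : P.osc f ≤ η := hη P (by change δ ≤ 2 * δ; linarith)
    have h4 : (fun x => (f x - P.avg f) + (h c - h x)) = fun x => f x - h x := by
      ext x
      change f x - P.avg f + (P.avg f - h x) = _
      ring
    rw [h4] at h1
    change P.avgAbs _ ≤ _
    linarith
  refine ⟨?_, hbig Q⟩
  rcases le_total δ Q.half with hQ | hQ
  · have h1 := Q.osc_le_two_mul_avgAbs (hfh Q)
    linarith [hbig Q hQ]
  · have h1 := Q.osc_add_le (hf Q) (hhi Q).neg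
    have h2 : Q.osc (fun x => (-h) x) = Q.osc h := Q.osc_neg h
    have h3 := Q.osc_le_two_mul (hhi Q) (h Q.center)
    have h4 : Q.avgAbs (fun x => h x - h Q.center) ≤ 2 * 2 ^ n * η :=
      Q.avgAbs_le (Q.integrableOn_sub_const (hhi Q) _) fun x hx =>
        hpt _ x (le_trans (show dist x Q.center ≤ Q.half from hx) hQ)
    have h5 : Q.osc f ≤ η := hη Q (by linarith)
    have h6 : Q.osc (fun x => f x - h x) ≤ η + 2 * (2 * 2 ^ n * η) := by
      simp only [sub_eq_add_neg]
      rw [h2] at h1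
      exact h1.trans (by linarith)
    have h7 : (1 : ℝ) ≤ 2 ^ n := one_le_pow₀ one_le_two
    refine h6.trans ?_
    nlinarith [mul_nonneg hη0 (sub_nonneg.2 h7), mul_nonneg (mul_nonneg hη0 (sub_nonneg.2 h7))
      (sub_nonneg.2 h7)]

lemma exists_hasCompactSupport_abs_sub_le {h : (Fin n → ℝ) → ℝ} (hh : Continuous h) {ε : ℝ}
    (hε : 0 ≤ ε) {R : ℝ} (hR : ∀ x, R < ‖x‖ → |h x| ≤ ε) :
    ∃ g : (Fin n → ℝ) → ℝ, Continuous g ∧ HasCompactSupport g ∧ ∀ x, |h x - g x| ≤ ε := by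
  refine ⟨fun x => h x - max (-ε) (min ε (h x)), by fun_prop, ?_, fun x => ?_⟩
  · refine HasCompactSupport.intro (isCompact_closedBall 0 R) fun x hx => ?_
    rw [mem_closedBall_zero_iff, not_le] at hx
    obtain ⟨h1, h2⟩ := abs_le.1 (hR x hx)
    rw [min_eq_right h2, max_eq_right h1, sub_self]
  · rw [sub_sub_cancel]
    exact abs_le.2 ⟨le_max_left _ _, max_le (by linarith) (min_le_left _ _)⟩

lemma exists_forall_abs_localAvg_le {f : (Fin n → ℝ) → ℝ} (hf : MemBmo Set.univ 1 f)
    (h : Tendsto (fun β =>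
      sSup {r | ∃ Q : Cube n, β < Q.distToOrigin ∧ 1 ≤ Q.side ∧ r = Q.avgAbs f}) atTop (𝓝 0))
    {δ : ℝ} (hδ : 0 < δ) (hδ1 : δ ≤ 1 / 2) {ε : ℝ} (hε : 0 < ε) :
    ∃ R : ℝ, ∀ x, R < ‖x‖ → |Cube.avg ⟨x, δ, hδ⟩ f| ≤ ε := by
  have hpos : 0 < (1 / (2 * δ)) ^ n := by positivity
  obtain ⟨β, hβ⟩ := (h.eventually_lt_const (div_pos hε hpos)).exists
  refine ⟨β + 1 / 2, fun x hx => ?_⟩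
  let P : Cube n := ⟨x, 1 / 2, by norm_num⟩
  have hP1 : P.side = 1 := by norm_num [P, Cube.side]
  have hdist : β < P.distToOrigin := by
    refine lt_of_lt_of_le (b := ‖x‖ - 1 / 2) (by linarith) ?_
    refine (le_infDist ⟨x, mem_closedBall_self P.half_pos.le⟩).2 fun y hy => ?_
    have h1 : dist y x ≤ 1 / 2 := hy
    have h2 := dist_triangle 0 y x
    rw [dist_zero_left x] at h2
    linarith
  have h1 : P.avgAbs f ≤ ε / (1 / (2 * δ)) ^ n := by
    have hmem : P.avgAbs f ∈
        {r | ∃ Q : Cube n, β < Q.distToOrigin ∧ 1 ≤ Q.side ∧ r = Q.avgAbs f} :=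
      ⟨P, hdist, hP1.ge, rfl⟩
    refine le_trans (le_csSup (hf.2.2.mono ?_) hmem) hβ.le
    rintro _ ⟨Q, -, hQ, rfl⟩
    exact ⟨Q, Set.subset_univ _, hQ, rfl⟩
  have h2 := Cube.avgAbs_le_of_subset (Q := ⟨x, δ, hδ⟩) (R := P)
    (closedBall_subset_closedBall hδ1) (hf.1 P (Set.subset_univ _))
  rw [hP1] at h2
  refine (Cube.abs_avg_le _ f).trans (h2.trans ?_)
  rw [mul_comm]
  exact (le_div_iff₀ hpos).1 h1

lemma exists_bmoNorm_sub_le {f : (Fin n → ℝ) → ℝ} (hf : MemBmo Set.univ 1 f)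
    (h1 : VanishSmallOsc Set.univ f)
    (h2 : Tendsto (fun β =>
      sSup {r | ∃ Q : Cube n, β < Q.distToOrigin ∧ 1 ≤ Q.side ∧ r = Q.avgAbs f}) atTop (𝓝 0))
    {ε : ℝ} (hε : 0 < ε) :
    ∃ g : (Fin n → ℝ) → ℝ, Continuous g ∧ HasCompactSupport g ∧
      bmoNorm Set.univ 1 (f - g) ≤ ε := by
  have hfi (Q : Cube n) : IntegrableOn f Q.toSet := hf.1 Q (Set.subset_univ _)
  obtain ⟨K, hK⟩ : ∃ K : ℝ, K = 2 ^ n * (1 + 2 * 2 ^ n) := ⟨_, rfl⟩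
  have hK0 : 0 < K := by rw [hK]; positivity
  obtain ⟨t, ht, hosc⟩ := exists_forall_osc_le hf h1 (ε := ε / (6 * K)) (by positivity)
  obtain ⟨δ, hδ, hδt, hδ1⟩ : ∃ δ : ℝ, 0 < δ ∧ 4 * δ < t ∧ δ ≤ 1 / 2 :=
    ⟨min (t / 8) (1 / 2), by positivity, by linarith [min_le_left (t / 8) (1 / 2)],
      min_le_right _ _⟩
  have happ := osc_avgAbs_sub_localAvg_le hfi hδ (η := ε / (6 * K)) fun Q hQ =>
    hosc Q (by
      change 2 * Q.half < t
      linarith)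
  have hKε : K * (ε / (6 * K)) = ε / 6 := by
    field_simp
  have hcont := Cube.continuous_avg hfi hδ
  obtain ⟨R, hR⟩ := exists_forall_abs_localAvg_le hf h2 hδ hδ1 (ε := ε / 6) (by positivity)
  obtain ⟨g, hg, hgs, hgε⟩ := exists_hasCompactSupport_abs_sub_le hcont (by positivity) hR
  refine ⟨g, hg, hgs, ?_⟩
  set h : (Fin n → ℝ) → ℝ := fun x => Cube.avg ⟨x, δ, hδ⟩ f
  have hhi (Q : Cube n) : IntegrableOn (fun x => f x - h x) Q.toSet :=
    (hfi Q).sub (hcont.continuousOn.integrableOn_compact Q.isCompact_toSet)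
  have hgi (Q : Cube n) : IntegrableOn (fun x => h x - g x) Q.toSet :=
    (hcont.sub hg).continuousOn.integrableOn_compact Q.isCompact_toSet
  have hsplit : f - g = fun x => (f x - h x) + (h x - g x) := by
    ext x
    simp
  have hsmall (Q : Cube n) : Q.avgAbs (fun x => h x - g x) ≤ ε / 6 :=
    Q.avgAbs_le (hgi Q) fun x _ => hgε x
  have hfin : bmoNorm Set.univ 1 (f - g) ≤ 2 * (ε / 6) + 2 * (ε / 6) + (ε / 6 + ε / 6) := by
    rw [hsplit]
    refine bmoNorm_univ_le (by positivity) (by positivity) (fun Q hQ => ?_) fun Q hQ => ?_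
    · have e1 := Q.osc_add_le (hhi Q) (hgi Q)
      have e2 := Q.osc_le_two_mul_avgAbs (hgi Q)
      have e3 := (happ Q).1
      rw [mul_assoc 2, ← hK, mul_assoc, hKε] at e3
      linarith [hsmall Q]
    · have e1 := Q.avgAbs_add_le (hhi Q) (hgi Q)
      have e3 := (happ Q).2 (by
        change 1 ≤ 2 * Q.half at hQ
        linarith)
      rw [← hK, hKε] at e3
      linarith [hsmall Q]
  linarith

/-- Characterization of cmo(ℝⁿ): f is in the bmo-closure of C_c(ℝⁿ) iff f has vanishing
mean oscillation and the averages |f|_Q over cubes with ℓ(Q) ≥ 1 vanish as dist(Q,0) → ∞. -/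
theorem stmt5 {n : ℕ} (hn : 0 < n) (f : (Fin n → ℝ) → ℝ)
    (hf : MemBmo (Set.univ : Set (Fin n → ℝ)) 1 f) :
    InCmoClosure (Set.univ : Set (Fin n → ℝ)) 1 f ↔
      (VanishSmallOsc (Set.univ : Set (Fin n → ℝ)) f ∧
        Tendsto (fun β =>
            sSup {r | ∃ Q : Cube n, β < Q.distToOrigin ∧ 1 ≤ Q.side ∧ r = Q.avgAbs f})
          atTop (nhds 0)) := by
  constructor
  · rintro ⟨g, hg, hlim⟩
    have happ (ε : ℝ) (hε : 0 < ε) : ∃ g : (Fin n → ℝ) → ℝ, Continuous g ∧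
        HasCompactSupport g ∧ MemBmo Set.univ 1 (f - g) ∧ bmoNorm Set.univ 1 (f - g) < ε := by
      obtain ⟨j, hj⟩ := (hlim.eventually_lt_const hε).exists
      obtain ⟨hc, hs, -⟩ := hg j
      obtain ⟨M, hM⟩ := hs.exists_bound_of_continuous hc
      exact ⟨g j, hc, hs, hf.sub_bounded hc hM, hj⟩
    have hsplit (g : (Fin n → ℝ) → ℝ) : f = fun x => (f - g) x + g x := by
      ext x
      simp
    refine ⟨vanishSmallOsc_of_forall fun ε hε => ?_, ?_⟩
    · obtain ⟨g, hc, hs, hmem, hlt⟩ := happ (ε / 2) (half_pos hε)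
      obtain ⟨t, ht, hosc⟩ := exists_forall_osc_le_of_uniformContinuous
        (hs.uniformContinuous_of_continuous hc) (half_pos hε)
      refine ⟨min t 1, lt_min ht one_pos, fun Q hQ => ?_⟩
      have h1 := Q.osc_add_le (hmem.1 Q (Set.subset_univ _))
        (hc.continuousOn.integrableOn_compact Q.isCompact_toSet)
      rw [← hsplit] at h1
      have h2 := hmem.osc_le_bmoNorm (Set.subset_univ _) (hQ.trans_le (min_le_right _ _))
      linarith [hosc Q (hQ.trans_le (min_le_left _ _))]
    · refine tendsto_order.2 ⟨fun a ha => Eventually.of_forall fun β => ha.trans_le ?_,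
        fun ε hε => ?_⟩
      · refine Real.sSup_nonneg ?_
        rintro _ ⟨Q, -, -, rfl⟩
        exact Q.avgAbs_nonneg f
      · obtain ⟨g, hc, hs, hmem, hlt⟩ := happ (ε / 2) (half_pos hε)
        obtain ⟨R, hR⟩ := hs.isCompact.isBounded.subset_closedBall 0
        filter_upwards [eventually_ge_atTop R] with β hβ
        refine lt_of_le_of_lt (Real.sSup_le ?_ (half_pos hε).le) (half_lt_self hε)
        rintro _ ⟨Q, hQβ, hQ, rfl⟩
        have h0 : Q.avgAbs g ≤ 0 := by
          refine Q.avgAbs_le (hc.continuousOn.integrableOn_compact Q.isCompact_toSet)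
            fun x hx => ?_
          have hgx : g x = 0 := by
            by_contra hne
            have h1 : dist x 0 ≤ R := hR (subset_tsupport g hne)
            have h2 : Q.distToOrigin ≤ dist 0 x := infDist_le_dist_of_mem hx
            rw [dist_comm] at h1
            linarith
          rw [hgx, abs_zero]
        have h1 := Q.avgAbs_add_le (hmem.1 Q (Set.subset_univ _))
          (hc.continuousOn.integrableOn_compact Q.isCompact_toSet)
        rw [← hsplit] at h1
        have h2 := hmem.avgAbs_le_bmoNorm (Set.subset_univ _) hQ
        linarith
  · rintro ⟨h1, h2⟩
    choose g hg hs hle using fun j : ℕ =>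
      exists_bmoNorm_sub_le hf h1 h2 (Nat.one_div_pos_of_nat (α := ℝ) (n := j))
    exact ⟨g, fun j => ⟨hg j, hs j, Set.subset_univ _⟩,
      squeeze_zero (fun j => bmoNorm_nonneg _ _ _) hle tendsto_one_div_add_atTop_nhds_zero_nat⟩
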